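/- (Bilinear Strichartz estimate for Airy.) Let m : ℝ² → ℂ satisfy |m(ξ₁,ξ₂)| ≤ |ξ₁+ξ₂|^{1/2}|ξ₁−ξ₂|^{1/2} for all ξ₁, ξ₂. Then for Airy evolutions u(t) = e^{-t∂_{xxx}}u₀ and v(t) = e^{-t∂_{xxx}}v₀ one has ‖ ∫∫ m(ξ₁,ξ₂) û(t,ξ₁) e^{ixξ₁} v̂(t,ξ₂) e^{ixξ₂} dξ₁ dξ₂ ‖_{L²_{t,x}(ℝ×ℝ)} ≤ C ‖u₀‖_{L²} ‖v₀‖_{L²} for an absolute constant C. -/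

import Mathlib

open MeasureTheory
open scoped FourierTransform

theorem fourier_cont (f : ℝ → ℂ) : Continuous (𝓕 f) := by
  by_cases hf : Integrable f
  · exact VectorFourier.fourierIntegral_continuous Real.continuous_fourierChar
      (by exact continuous_inner) hf
  · have : 𝓕 f = fun _ => 0 := by
      ext w
      rw [Real.fourier_eq]
      apply integral_undef
      rwa [Real.fourierIntegral_convergent_iff]
    rw [this]
    exact continuous_const

theorem plancherel_memLp (f : ℝ → ℂ) (hf : Integrable f) (hf2 : MemLp f 2) :
    eLpNorm (𝓕 f) 2 volume = eLpNorm f 2 volume := by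
  set L : Lp ℂ 2 (volume : Measure ℝ) := hf2.toLp f with hL
  have key : ∀ᵐ x, (𝓕 L : Lp ℂ 2 (volume : Measure ℝ)) x = 𝓕 f x := by
    apply ae_eq_of_integral_contDiff_smul_eq
    · exact (Lp.memLp _).locallyIntegrable (by norm_num)
    · exact (fourier_cont f).locallyIntegrable
    · intro g g_smooth g_cpt
      have hg₁ : HasCompactSupport (Complex.ofRealCLM ∘ g) := g_cpt.comp_left rfl
      have hg₂ : ContDiff ℝ (⊤ : ℕ∞) (Complex.ofRealCLM ∘ g) := by fun_prop
      set G := hg₁.toSchwartzMap hg₂ with hG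
      have h1 : ∫ x, g x • (𝓕 L : Lp ℂ 2 (volume : Measure ℝ)) x
          = Lp.toTemperedDistribution (𝓕 L : Lp ℂ 2 (volume : Measure ℝ)) G := by
        rw [Lp.toTemperedDistribution_apply]; simp [hG]
      rw [h1, ← Lp.fourier_toTemperedDistribution_eq, TemperedDistribution.fourier_apply,
        Lp.toTemperedDistribution_apply]
      have h2 : ∫ x, (𝓕 G : SchwartzMap ℝ ℂ) x • L x = ∫ x, (𝓕 G : SchwartzMap ℝ ℂ) x • f x := by
        apply integral_congr_ae
        filter_upwards [hf2.coeFn_toLp] with x hx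
        rw [hL, hx]
      rw [h2, SchwartzMap.fourier_coe]
      have := VectorFourier.integral_fourierIntegral_smul_eq_flip (μ := volume) (ν := volume)
        (f := (G : ℝ → ℂ)) (g := f) (L := innerₗ ℝ) Real.continuous_fourierChar
        (by exact continuous_inner) G.integrable hf
      rw [flip_innerₗ] at this
      refine this.trans ?_
      apply integral_congr_ae
      filter_upwards with x
      simp [hG]
      exact Or.inl rfl
  have e1 : eLpNorm (𝓕 f) 2 volume = eLpNorm (𝓕 L : Lp ℂ 2 (volume : Measure ℝ)) 2 volume :=
    (eLpNorm_congr_ae key).symm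
  have e2 : eLpNorm f 2 volume = eLpNorm L 2 volume := (eLpNorm_congr_ae hf2.coeFn_toLp).symm
  rw [e1, e2, ← Lp.enorm_def, ← Lp.enorm_def, ← ofReal_norm, ← ofReal_norm, Lp.norm_fourier_eq]

theorem plancherel_le (f : ℝ → ℂ) : eLpNorm (𝓕 f) 2 volume ≤ eLpNorm f 2 volume := by
  by_cases hf : Integrable f
  · by_cases h2 : eLpNorm f 2 volume = ⊤
    · rw [h2]; exact le_top
    · exact (plancherel_memLp f hf ⟨hf.1, lt_top_iff_ne_top.2 h2⟩).le
  · have : 𝓕 f = fun _ => 0 := by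
      ext w
      rw [Real.fourier_eq]
      apply integral_undef
      rwa [Real.fourierIntegral_convergent_iff]
    rw [this]
    simp

theorem sq_eLpNorm {α : Type*} [MeasurableSpace α] (μ : Measure α) (f : α → ℂ) :
    eLpNorm f 2 μ = (∫⁻ x, ‖f x‖ₑ ^ 2 ∂μ) ^ (1 / 2 : ℝ) := by
  rw [eLpNorm_eq_lintegral_rpow_enorm_toReal (by norm_num) (by norm_num)]
  simp

theorem plancherel_sq (f : ℝ → ℂ) : ∫⁻ x, ‖𝓕 f x‖ₑ ^ 2 ≤ ∫⁻ x, ‖f x‖ₑ ^ 2 := by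
  have := plancherel_le f
  rw [sq_eLpNorm, sq_eLpNorm] at this
  exact (ENNReal.rpow_le_rpow_iff (by norm_num)).1 this

/-- Plancherel with the angular convention. -/
theorem plancherel_ang (f : ℝ → ℂ) :
    ∫⁻ b : ℝ, ‖∫ x : ℝ, f x * Complex.exp (Complex.I * (x * b))‖ₑ ^ 2
      ≤ ENNReal.ofReal (2 * Real.pi) * ∫⁻ x, ‖f x‖ₑ ^ 2 := by
  have h : ∀ b : ℝ, ∫ x : ℝ, f x * Complex.exp (Complex.I * (x * b))
      = 𝓕 f ((-(2 * Real.pi)⁻¹) * b) := by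
    intro b
    rw [Real.fourier_real_eq_integral_exp_smul]
    congr 1
    ext x
    rw [smul_eq_mul, mul_comm]
    congr 2
    have := Real.pi_ne_zero
    push_cast
    field_simp
  simp_rw [h]
  have hm : Measurable (fun x => ‖𝓕 f x‖ₑ ^ 2) := ((fourier_cont f).measurable.enorm).pow_const 2
  have := lintegral_map (μ := volume) hm (measurable_const_mul (-(2 * Real.pi)⁻¹))
  rw [← this, Real.map_volume_mul_left (by have := Real.pi_ne_zero; simp [this]),
    lintegral_smul_measure, smul_eq_mul]
  have e : |(-(2 * Real.pi)⁻¹)⁻¹| = 2 * Real.pi := by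
    rw [inv_neg, inv_inv, abs_neg, abs_of_pos (by positivity)]
  rw [e]
  exact mul_le_mul_right (plancherel_sq f) _

/-- Two dimensional Bessel inequality. -/
theorem plancherel_two (φ : ℝ × ℝ → ℂ) (hφ : Measurable φ) (hi : Integrable φ) :
    ∫⁻ q : ℝ × ℝ, ‖∫ p : ℝ × ℝ, φ p * Complex.exp (Complex.I * (p.1 * q.1 + p.2 * q.2))‖ₑ ^ 2
      ≤ ENNReal.ofReal (2 * Real.pi) * (ENNReal.ofReal (2 * Real.pi) * ∫⁻ p, ‖φ p‖ₑ ^ 2) := by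
  set ψ : ℝ → ℝ → ℂ := fun b t => ∫ x : ℝ, φ (t, x) * Complex.exp (Complex.I * (x * b)) with hψ
  have hψm : StronglyMeasurable (Function.uncurry ψ) := by
    have : StronglyMeasurable (Function.uncurry (fun (q : ℝ × ℝ) (x : ℝ) =>
        φ (q.2, x) * Complex.exp (Complex.I * (x * q.1)))) := by
      apply Measurable.stronglyMeasurable
      unfold Function.uncurry
      fun_prop
    exact this.integral_prod_right
  have hΦ : ∀ q : ℝ × ℝ, ∫ p : ℝ × ℝ, φ p * Complex.exp (Complex.I * (p.1 * q.1 + p.2 * q.2))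
      = ∫ t, ψ q.2 t * Complex.exp (Complex.I * (t * q.1)) := by
    intro q
    have hint : Integrable (fun p : ℝ × ℝ =>
        φ p * Complex.exp (Complex.I * (p.1 * q.1 + p.2 * q.2))) := by
      refine hi.mul_bdd (c := 1) ?_ ?_
      · apply Measurable.aestronglyMeasurable; fun_prop
      · filter_upwards with p
        have := Complex.norm_exp_I_mul_ofReal (p.1 * q.1 + p.2 * q.2)
        push_cast at this
        exact this.le
    rw [Measure.volume_eq_prod] at hint ⊢
    rw [integral_prod _ hint]
    congr 1
    ext t
    rw [hψ]
    simp only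
    rw [← integral_mul_const]
    congr 1
    ext x
    rw [mul_assoc, ← Complex.exp_add]
    congr 2
    ring
  simp_rw [hΦ]
  have hΦm : Measurable (fun q : ℝ × ℝ => ‖∫ t, ψ q.2 t * Complex.exp (Complex.I * (t * q.1))‖ₑ ^ 2) := by
    have : StronglyMeasurable (Function.uncurry (fun (q : ℝ × ℝ) (t : ℝ) =>
        ψ q.2 t * Complex.exp (Complex.I * (t * q.1)))) := by
      apply Measurable.stronglyMeasurable
      unfold Function.uncurry
      apply Measurable.mul
      · exact hψm.measurable.comp (by fun_prop : Measurable (fun r : (ℝ × ℝ) × ℝ => (r.1.2, r.2)))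
      · fun_prop
    exact (this.integral_prod_right.measurable.enorm).pow_const 2
  rw [Measure.volume_eq_prod, lintegral_prod_symm _ hΦm.aemeasurable]
  calc ∫⁻ b : ℝ, ∫⁻ a : ℝ, ‖∫ t, ψ b t * Complex.exp (Complex.I * (t * a))‖ₑ ^ 2
      ≤ ∫⁻ b : ℝ, ENNReal.ofReal (2 * Real.pi) * ∫⁻ t, ‖ψ b t‖ₑ ^ 2 :=
        lintegral_mono fun b => plancherel_ang (ψ b)
    _ = ENNReal.ofReal (2 * Real.pi) * ∫⁻ b : ℝ, ∫⁻ t, ‖ψ b t‖ₑ ^ 2 :=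
        lintegral_const_mul' _ _ ENNReal.ofReal_ne_top
    _ = ENNReal.ofReal (2 * Real.pi) * ∫⁻ t : ℝ, ∫⁻ b, ‖ψ b t‖ₑ ^ 2 := by
        rw [lintegral_lintegral_swap]
        exact ((hψm.measurable.enorm).pow_const 2).aemeasurable
    _ ≤ ENNReal.ofReal (2 * Real.pi) *
          ∫⁻ t : ℝ, ENNReal.ofReal (2 * Real.pi) * ∫⁻ x, ‖φ (t, x)‖ₑ ^ 2 := by
        gcongr with t
        exact plancherel_ang (fun x => φ (t, x))
    _ = _ := by
        rw [lintegral_const_mul' _ _ ENNReal.ofReal_ne_top,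
          lintegral_prod _ ((hφ.enorm.pow_const 2).aemeasurable)]

noncomputable def ee (p q : ℝ × ℝ) : ℂ := Complex.exp (Complex.I * (p.1 * q.1 + p.2 * q.2))

theorem ee_norm (p q : ℝ × ℝ) : ‖ee p q‖ = 1 := by
  have := Complex.norm_exp_I_mul_ofReal (p.1 * q.1 + p.2 * q.2)
  push_cast at this
  exact this

theorem ee_cont : Continuous (fun r : (ℝ × ℝ) × (ℝ × ℝ) => ee r.1 r.2) := by
  unfold ee; fun_prop

def psi (ξ : ℝ × ℝ) : ℝ × ℝ := (ξ.1 ^ 3 + ξ.2 ^ 3, ξ.1 + ξ.2)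

theorem psi_cont : Continuous psi := by unfold psi; fun_prop

noncomputable def psiDeriv (ξ : ℝ × ℝ) : ℝ × ℝ →L[ℝ] ℝ × ℝ :=
  (Matrix.toLin (Module.Basis.finTwoProd ℝ) (Module.Basis.finTwoProd ℝ)
    !![3 * ξ.1 ^ 2, 3 * ξ.2 ^ 2; 1, 1]).toContinuousLinearMap

theorem psi_hasFDerivAt (ξ : ℝ × ℝ) : HasFDerivAt psi (psiDeriv ξ) ξ := by
  unfold psiDeriv psi
  rw [Matrix.toLin_finTwoProd_toContinuousLinearMap]
  convert! HasFDerivAt.prodMk (𝕜 := ℝ)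
    (((hasDerivAt_pow 3 ξ.1).comp_hasFDerivAt ξ hasFDerivAt_fst).add
      ((hasDerivAt_pow 3 ξ.2).comp_hasFDerivAt ξ hasFDerivAt_snd))
    ((hasFDerivAt_fst (𝕜 := ℝ) (p := ξ)).add hasFDerivAt_snd) using 2 <;> simp

theorem psiDeriv_det (ξ : ℝ × ℝ) : (psiDeriv ξ).det = 3 * ((ξ.1 + ξ.2) * (ξ.1 - ξ.2)) := by
  unfold psiDeriv
  rw [LinearMap.det_toContinuousLinearMap, LinearMap.det_toLin, Matrix.det_fin_two_of]
  ring

theorem psi_aux {a b c d : ℝ} (hs : a + b ≠ 0) (h1 : a ^ 3 + b ^ 3 = c ^ 3 + d ^ 3)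
    (h2 : a + b = c + d) : (a - c) * (a - d) = 0 := by
  have e : (a + b) * ((a - c) * (a - d)) = 0 := by
    have hd : d = a + b - c := by linarith
    subst hd
    have : a ^ 3 + b ^ 3 - (c ^ 3 + (a + b - c) ^ 3) = 0 := by linarith
    linear_combination (1 / 3 : ℝ) * this
  exact (mul_eq_zero.1 e).resolve_left hs

theorem cov_half (S : Set (ℝ × ℝ)) (hS : MeasurableSet S) (hinj : Set.InjOn psi S)
    (Ψ : ℝ × ℝ → ENNReal) :
    ∫⁻ ξ in S, ENNReal.ofReal (|ξ.1 + ξ.2| * |ξ.1 - ξ.2|) * Ψ (psi ξ) ≤ ∫⁻ q, Ψ q := by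
  calc ∫⁻ ξ in S, ENNReal.ofReal (|ξ.1 + ξ.2| * |ξ.1 - ξ.2|) * Ψ (psi ξ)
      ≤ ∫⁻ ξ in S, ENNReal.ofReal |(psiDeriv ξ).det| * Ψ (psi ξ) := by
        apply lintegral_mono
        intro ξ
        dsimp only
        rw [psiDeriv_det, abs_mul, abs_mul]
        refine mul_le_mul_left (ENNReal.ofReal_le_ofReal ?_) _
        rw [abs_of_pos (by norm_num : (0 : ℝ) < 3)]
        nlinarith [mul_nonneg (abs_nonneg (ξ.1 + ξ.2)) (abs_nonneg (ξ.1 - ξ.2))]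
    _ = ∫⁻ q in psi '' S, Ψ q :=
        (lintegral_image_eq_lintegral_abs_det_fderiv_mul volume hS
          (fun ξ _ => (psi_hasFDerivAt ξ).hasFDerivWithinAt) hinj Ψ).symm
    _ ≤ _ := setLIntegral_le_lintegral _ _

theorem cov (Ψ : ℝ × ℝ → ENNReal) (hΨ : Measurable Ψ) :
    ∫⁻ ξ : ℝ × ℝ, ENNReal.ofReal (|ξ.1 + ξ.2| * |ξ.1 - ξ.2|) * Ψ (psi ξ) ≤ 2 * ∫⁻ q, Ψ q := by
  set S₁ : Set (ℝ × ℝ) := {ξ | ξ.2 < ξ.1 ∧ ξ.1 + ξ.2 ≠ 0} with hS₁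
  set S₂ : Set (ℝ × ℝ) := {ξ | ξ.1 < ξ.2 ∧ ξ.1 + ξ.2 ≠ 0} with hS₂
  have m0 : MeasurableSet {ξ : ℝ × ℝ | ξ.1 + ξ.2 ≠ 0} :=
    (measurableSet_eq_fun (by fun_prop) measurable_const).compl
  have m₁ : MeasurableSet S₁ := (measurableSet_lt measurable_snd measurable_fst).inter m0
  have m₂ : MeasurableSet S₂ := (measurableSet_lt measurable_fst measurable_snd).inter m0
  have i₁ : Set.InjOn psi S₁ := by
    rintro ⟨a, b⟩ ⟨h1, h2⟩ ⟨c, d⟩ ⟨h3, h4⟩ h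
    simp only [psi, Prod.mk.injEq] at h h1 h2 h3 h4 ⊢
    rcases mul_eq_zero.1 (psi_aux h2 h.1 h.2) with h5 | h5
    · constructor <;> linarith [h.2]
    · linarith [h.2]
  have i₂ : Set.InjOn psi S₂ := by
    rintro ⟨a, b⟩ ⟨h1, h2⟩ ⟨c, d⟩ ⟨h3, h4⟩ h
    simp only [psi, Prod.mk.injEq] at h h1 h2 h3 h4 ⊢
    rcases mul_eq_zero.1 (psi_aux h2 h.1 h.2) with h5 | h5
    · constructor <;> linarith [h.2]
    · linarith [h.2]
  set f : ℝ × ℝ → ENNReal :=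
    fun ξ => ENNReal.ofReal (|ξ.1 + ξ.2| * |ξ.1 - ξ.2|) * Ψ (psi ξ) with hf
  have hfm : Measurable f := by
    apply Measurable.mul
    · fun_prop
    · exact hΨ.comp psi_cont.measurable
  calc ∫⁻ ξ, f ξ ≤ ∫⁻ ξ, (S₁.indicator f ξ + S₂.indicator f ξ) := by
        apply lintegral_mono
        intro ξ
        by_cases hs : ξ.1 + ξ.2 = 0
        · simp [hf, hs]
        rcases lt_trichotomy ξ.1 ξ.2 with h | h | h
        · have : ξ ∈ S₂ := ⟨h, hs⟩
          simp [this]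
        · simp [hf, h]
        · have : ξ ∈ S₁ := ⟨h, hs⟩
          simp [this]
    _ = (∫⁻ ξ in S₁, f ξ) + (∫⁻ ξ in S₂, f ξ) := by
        rw [lintegral_add_left (hfm.indicator m₁), lintegral_indicator m₁, lintegral_indicator m₂]
    _ ≤ _ := by
        rw [two_mul]
        exact add_le_add (cov_half S₁ m₁ i₁ Ψ) (cov_half S₂ m₂ i₂ Ψ)

noncomputable def ww (ξ₁ ξ₂ : ℝ) : ℝ :=
  |ξ₁ + ξ₂| ^ ((1 : ℝ) / 2) * |ξ₁ - ξ₂| ^ ((1 : ℝ) / 2)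

theorem ww_sq (ξ₁ ξ₂ : ℝ) : ENNReal.ofReal (ww ξ₁ ξ₂) ^ 2
    = ENNReal.ofReal (|ξ₁ + ξ₂| * |ξ₁ - ξ₂|) := by
  have h0 : 0 ≤ ww ξ₁ ξ₂ := by unfold ww; positivity
  rw [← ENNReal.ofReal_pow h0]
  congr 1
  unfold ww
  rw [← Real.sqrt_eq_rpow, ← Real.sqrt_eq_rpow, mul_pow, Real.sq_sqrt (abs_nonneg _),
    Real.sq_sqrt (abs_nonneg _)]

/-- The dual estimate. -/
theorem dual_estimate (h : ℝ → ℝ → ℂ) (G H : ℝ → ℂ) (hG : Continuous G) (hH : Continuous H)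
    (hint : ∀ ξ₁, Integrable (h ξ₁))
    (hb : ∀ ξ₁ ξ₂, ‖h ξ₁ ξ₂‖ₑ ≤ ENNReal.ofReal (ww ξ₁ ξ₂) * (‖G ξ₁‖ₑ * ‖H ξ₂‖ₑ))
    (φ : ℝ × ℝ → ℂ) (hφ : Measurable φ) (hφi : Integrable φ) :
    ∫⁻ ξ₁, ‖∫ p, (∫ ξ₂, h ξ₁ ξ₂ * ee p (psi (ξ₁, ξ₂))) * φ p‖ₑ
      ≤ (ENNReal.ofReal (4 * Real.pi) * eLpNorm G 2 volume * eLpNorm H 2 volume)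
        * eLpNorm φ 2 volume := by
  set Φ : ℝ × ℝ → ℂ := fun q => ∫ p, φ p * ee p q with hΦ
  have hΦc : Continuous Φ := by
    refine continuous_of_dominated (bound := fun p => ‖φ p‖) ?_ ?_ hφi.norm ?_
    · intro q
      apply Measurable.aestronglyMeasurable
      exact hφ.mul (ee_cont.comp (by fun_prop : Continuous fun p : ℝ × ℝ => (p, q))).measurable
    · intro q
      filter_upwards with p
      rw [norm_mul, ee_norm, mul_one]
    · filter_upwards with p
      exact continuous_const.mul (ee_cont.comp (by fun_prop : Continuous fun q : ℝ × ℝ => (p, q)))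
  have swap : ∀ ξ₁, ∫ p, (∫ ξ₂, h ξ₁ ξ₂ * ee p (psi (ξ₁, ξ₂))) * φ p
      = ∫ ξ₂, h ξ₁ ξ₂ * Φ (psi (ξ₁, ξ₂)) := by
    intro ξ₁
    have e1 : ∀ p, (∫ ξ₂, h ξ₁ ξ₂ * ee p (psi (ξ₁, ξ₂))) * φ p
        = ∫ ξ₂, h ξ₁ ξ₂ * ee p (psi (ξ₁, ξ₂)) * φ p := fun p => (integral_mul_const _ _).symm
    simp_rw [e1]
    rw [integral_integral_swap]
    · congr 1
      ext ξ₂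
      rw [hΦ]
      simp only
      rw [← integral_const_mul]
      congr 1
      ext p
      ring
    · have i1 : Integrable (fun z : (ℝ × ℝ) × ℝ => φ z.1 * h ξ₁ z.2)
          ((volume : Measure (ℝ × ℝ)).prod (volume : Measure ℝ)) := hφi.mul_prod (hint ξ₁)
      have i2 : Integrable (fun z : (ℝ × ℝ) × ℝ => (φ z.1 * h ξ₁ z.2) * ee z.1 (psi (ξ₁, z.2)))
          ((volume : Measure (ℝ × ℝ)).prod (volume : Measure ℝ)) := by
        refine i1.mul_bdd (c := 1) ?_ ?_
        · apply Continuous.aestronglyMeasurable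
          exact ee_cont.comp (continuous_fst.prodMk (psi_cont.comp (by fun_prop)))
        · filter_upwards with z
          rw [ee_norm]
      refine i2.congr ?_
      filter_upwards with z
      simp only [Function.uncurry]
      ring
  simp_rw [swap]
  set g1 : ℝ × ℝ → ENNReal := fun ξ => ‖G ξ.1‖ₑ * ‖H ξ.2‖ₑ with hg1
  set g2 : ℝ × ℝ → ENNReal := fun ξ => ENNReal.ofReal (ww ξ.1 ξ.2) * ‖Φ (psi ξ)‖ₑ with hg2
  have hg1m : Measurable g1 := by
    have a1 : Measurable fun ξ : ℝ × ℝ => ‖G ξ.1‖ₑ := (hG.measurable.comp measurable_fst).enorm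
    have a2 : Measurable fun ξ : ℝ × ℝ => ‖H ξ.2‖ₑ := (hH.measurable.comp measurable_snd).enorm
    exact a1.mul a2
  have hg2m : Measurable g2 := by
    have a1 : Measurable fun ξ : ℝ × ℝ => ENNReal.ofReal (ww ξ.1 ξ.2) := by unfold ww; fun_prop
    have a2 : Measurable fun ξ : ℝ × ℝ => ‖Φ (psi ξ)‖ₑ := (hΦc.comp psi_cont).measurable.enorm
    exact a1.mul a2
  calc ∫⁻ ξ₁, ‖∫ ξ₂, h ξ₁ ξ₂ * Φ (psi (ξ₁, ξ₂))‖ₑ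
      ≤ ∫⁻ ξ₁, ∫⁻ ξ₂, (g1 * g2) (ξ₁, ξ₂) := by
        apply lintegral_mono
        intro ξ₁
        refine (enorm_integral_le_lintegral_enorm _).trans ?_
        apply lintegral_mono
        intro ξ₂
        simp only [enorm_mul, Pi.mul_apply, hg1, hg2]
        calc _ ≤ ENNReal.ofReal (ww ξ₁ ξ₂) * (‖G ξ₁‖ₑ * ‖H ξ₂‖ₑ) * ‖Φ (psi (ξ₁, ξ₂))‖ₑ :=
              mul_le_mul_left (hb ξ₁ ξ₂) _
          _ = _ := by ring
    _ = ∫⁻ ξ, (g1 * g2) ξ := by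
        rw [Measure.volume_eq_prod, lintegral_prod _ (hg1m.mul hg2m).aemeasurable]
    _ ≤ (∫⁻ ξ, g1 ξ ^ (2 : ℝ)) ^ (1 / (2 : ℝ)) * (∫⁻ ξ, g2 ξ ^ (2 : ℝ)) ^ (1 / (2 : ℝ)) :=
        ENNReal.lintegral_mul_le_Lp_mul_Lq volume Real.HolderConjugate.two_two
          hg1m.aemeasurable hg2m.aemeasurable
    _ ≤ (eLpNorm G 2 volume * eLpNorm H 2 volume) *
          (ENNReal.ofReal (4 * Real.pi) * eLpNorm φ 2 volume) := by
        gcongr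
        · rw [sq_eLpNorm, sq_eLpNorm, ← ENNReal.mul_rpow_of_nonneg _ _ (by norm_num)]
          apply le_of_eq
          congr 1
          rw [Measure.volume_eq_prod, ← lintegral_prod_mul
            (hG.measurable.enorm.pow_const 2).aemeasurable
            (hH.measurable.enorm.pow_const 2).aemeasurable]
          congr 1
          ext ξ
          simp [hg1, mul_pow]
        · have e : ENNReal.ofReal (4 * Real.pi)
              = (ENNReal.ofReal (4 * Real.pi) ^ 2) ^ (1 / 2 : ℝ) := by
            rw [← ENNReal.rpow_natCast, ← ENNReal.rpow_mul]; simp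
          rw [sq_eLpNorm, e, ← ENNReal.mul_rpow_of_nonneg _ _ (by norm_num)]
          apply ENNReal.rpow_le_rpow _ (by norm_num)
          calc ∫⁻ ξ, g2 ξ ^ (2 : ℝ)
              = ∫⁻ ξ : ℝ × ℝ, ENNReal.ofReal (|ξ.1 + ξ.2| * |ξ.1 - ξ.2|)
                  * (fun q => ‖Φ q‖ₑ ^ 2) (psi ξ) := by
                congr 1
                ext ξ
                simp [hg2, mul_pow, ww_sq]
            _ ≤ 2 * ∫⁻ q, ‖Φ q‖ₑ ^ 2 := cov _ (hΦc.measurable.enorm.pow_const 2)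
            _ ≤ 2 * (ENNReal.ofReal (2 * Real.pi) *
                  (ENNReal.ofReal (2 * Real.pi) * ∫⁻ p, ‖φ p‖ₑ ^ 2)) :=
                mul_le_mul_right (plancherel_two φ hφ hφi) _
            _ = (2 * (ENNReal.ofReal (2 * Real.pi) * ENNReal.ofReal (2 * Real.pi)))
                  * ∫⁻ p, ‖φ p‖ₑ ^ 2 := by ring
            _ ≤ _ := by
                apply mul_le_mul_left
                rw [← ENNReal.ofReal_mul (by positivity), ← ENNReal.ofReal_pow (by positivity),
                  show (2 : ENNReal) = ENNReal.ofReal 2 by simp, ← ENNReal.ofReal_mul (by positivity)]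
                apply ENNReal.ofReal_le_ofReal
                nlinarith [sq_nonneg Real.pi]
    _ = _ := by ring

theorem ennreal_sq_cancel {A K : ENNReal} (hA : A ≠ ⊤) (h : A ≤ K * A ^ (1 / 2 : ℝ)) :
    A ≤ K ^ 2 := by
  by_cases h0 : A = 0
  · rw [h0]; exact zero_le
  set B := A ^ (1 / 2 : ℝ) with hB
  have hAB : A = B * B := by
    rw [hB, ← ENNReal.rpow_add _ _ h0 hA]; norm_num
  have hB0 : B ≠ 0 := by
    intro hb; rw [hb] at hAB; simp at hAB; exact h0 hAB
  have hBt : B ≠ ⊤ := ENNReal.rpow_ne_top_of_nonneg (by norm_num) hA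
  rw [hAB] at h ⊢
  have : B ≤ K := (ENNReal.mul_le_mul_iff_left hB0 hBt).1 h
  rw [sq]
  exact mul_le_mul' this this

/-- A duality argument which does not presuppose any measurability of `J` in `ξ`. -/
theorem duality (J : ℝ → ℝ × ℝ → ℂ) (hc : ∀ ξ, Continuous (J ξ)) (K : ENNReal)
    (hdual : ∀ φ : ℝ × ℝ → ℂ, Measurable φ → Integrable φ →
      ∫⁻ ξ, ‖∫ p, J ξ p * φ p‖ₑ ≤ K * eLpNorm φ 2 volume) :
    eLpNorm (fun p => ∫ ξ, J ξ p) 2 volume ≤ K := by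
  set F : ℝ × ℝ → ℂ := fun p => ∫ ξ, J ξ p with hF
  obtain ⟨g, hgm, hgle, hgeq⟩ :=
    exists_measurable_le_lintegral_eq (volume : Measure (ℝ × ℝ)) (fun p => ‖F p‖ₑ ^ 2)
  set E : Set (ℝ × ℝ) := {p | g p ≠ 0} with hE
  have hEm : MeasurableSet E := (measurableSet_eq_fun hgm measurable_const).compl
  have hint : ∀ p ∈ E, Integrable (fun ξ => J ξ p) := by
    intro p hp
    by_contra hni
    have : F p = 0 := integral_undef hni
    have h2 := hgle p
    simp only [this] at h2
    simp at h2
    exact hp h2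
  obtain ⟨s, hsc, hsd⟩ := TopologicalSpace.exists_countable_dense E
  have hae : ∀ᵐ ξ : ℝ, ∀ d (hd : d ∈ s), J ξ d = (hint d d.2).1.mk _ ξ := by
    rw [ae_ball_iff hsc]
    intro d hd
    exact (hint d d.2).1.ae_eq_mk
  obtain ⟨N, hNsub, hNm, hN0⟩ := exists_measurable_superset_of_null hae
  set T : Set ℝ := Nᶜ with hT
  have hTm : MeasurableSet T := hNm.compl
  have hTae : ∀ᵐ ξ, ξ ∈ T := by
    rw [ae_iff]
    simpa [hT] using hN0
  have hTs : ∀ ξ ∈ T, ∀ d (hd : d ∈ s), J ξ d = (hint d d.2).1.mk _ ξ := by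
    intro ξ hξ
    by_contra hcon
    exact hξ (hNsub hcon)
  set J' : E → ℝ → ℂ := fun p => T.indicator (fun ξ => J ξ p) with hJ'
  have hJc : ∀ ξ, Continuous fun p : E => J' p ξ := by
    intro ξ
    by_cases hξ : ξ ∈ T
    · simp only [hJ', Set.indicator_of_mem hξ]
      exact (hc ξ).comp continuous_subtype_val
    · simp only [hJ', Set.indicator_of_notMem hξ]
      exact continuous_const
  have hJs : ∀ d ∈ s, Measurable (J' d) := by
    intro d hd
    have : J' d = T.indicator ((hint d d.2).1.mk _) := by
      apply Set.indicator_congr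
      intro ξ hξ
      exact hTs ξ hξ d hd
    rw [this]
    exact ((hint d d.2).1.stronglyMeasurable_mk.measurable).indicator hTm
  have hJm : ∀ p, Measurable (J' p) := by
    intro p
    obtain ⟨x, hx, hxl⟩ := mem_closure_iff_seq_limit.1 (hsd p)
    refine measurable_of_tendsto_metrizable (fun n => hJs (x n) (hx n)) ?_
    rw [tendsto_pi_nhds]
    intro ξ
    exact ((hJc ξ).tendsto p).comp hxl
  have hJ'm : Measurable (Function.uncurry J') :=
    measurable_uncurry_of_continuous_of_measurable hJc hJm
  have hemb : MeasurableEmbedding (Prod.map (Subtype.val : E → ℝ × ℝ) (id : ℝ → ℝ)) :=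
    (MeasurableEmbedding.subtype_coe hEm).prodMap MeasurableEmbedding.id
  set Jt : (ℝ × ℝ) × ℝ → ℂ :=
    Function.extend (Prod.map (Subtype.val : E → ℝ × ℝ) (id : ℝ → ℝ)) (Function.uncurry J')
      (fun _ => 0) with hJt
  have hJtm : Measurable Jt := hemb.measurable_extend hJ'm measurable_const
  have hJtE : ∀ p ∈ E, ∀ ξ ∈ T, Jt (p, ξ) = J ξ p := by
    intro p hp ξ hξ
    have := hemb.injective.extend_apply (Function.uncurry J') (fun _ => 0) (⟨p, hp⟩, ξ)
    simp only [Prod.map, id, Function.uncurry] at this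
    rw [hJt]
    refine this.trans ?_
    simp [hJ', hξ]
  set Ft : ℝ × ℝ → ℂ := fun p => ∫ ξ, Jt (p, ξ) with hFt
  have hFtm : Measurable Ft := by
    have : StronglyMeasurable (Function.uncurry fun (p : ℝ × ℝ) (ξ : ℝ) => Jt (p, ξ)) :=
      hJtm.stronglyMeasurable
    exact this.integral_prod_right.measurable
  set M : ℝ × ℝ → ENNReal := fun p => ∫⁻ ξ, ‖Jt (p, ξ)‖ₑ with hM
  have hMm : Measurable M := hJtm.enorm.lintegral_prod_right'
  have hFtE : ∀ p ∈ E, Ft p = F p := by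
    intro p hp
    apply integral_congr_ae
    filter_upwards [hTae] with ξ hξ using hJtE p hp ξ hξ
  have hME : ∀ p ∈ E, M p < ⊤ := by
    intro p hp
    have : M p = ∫⁻ ξ, ‖J ξ p‖ₑ := by
      apply lintegral_congr_ae
      filter_upwards [hTae] with ξ hξ
      rw [hJtE p hp ξ hξ]
    rw [this]
    exact (hint p hp).2
  set En : ℕ → Set (ℝ × ℝ) := fun n => {p | p ∈ E ∧ M p ≤ n} ∩ Metric.closedBall 0 n with hEn
  have hEnm : ∀ n, MeasurableSet (En n) := fun n =>
    (hEm.inter (measurableSet_le hMm measurable_const)).inter measurableSet_closedBall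
  have hEnfin : ∀ n, volume (En n) < ⊤ := fun n =>
    (measure_mono Set.inter_subset_right).trans_lt measure_closedBall_lt_top
  have hEnmono : Monotone En := by
    intro a b hab p hp
    have hab' : (a : ℝ) ≤ b := by exact_mod_cast hab
    refine ⟨⟨hp.1.1, hp.1.2.trans (by exact_mod_cast hab)⟩,
      Metric.closedBall_subset_closedBall hab' hp.2⟩
  have hEnU : E ⊆ ⋃ n, En n := by
    intro p hp
    obtain ⟨a, ha⟩ := ENNReal.exists_nat_gt (hME p hp).ne
    obtain ⟨b, hb⟩ := exists_nat_ge ‖p‖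
    rw [Set.mem_iUnion]
    refine ⟨max a b, ⟨hp, ha.le.trans (by exact_mod_cast le_max_left a b)⟩, ?_⟩
    rw [mem_closedBall_zero_iff]
    exact hb.trans (by exact_mod_cast le_max_right a b)
  have main : ∀ n, ∫⁻ p in En n, ‖Ft p‖ₑ ^ 2 ≤ K ^ 2 := by
    intro n
    set φ : ℝ × ℝ → ℂ := (En n).indicator (fun p => (starRingEnd ℂ) (Ft p)) with hφ
    have hφm : Measurable φ := by
      apply Measurable.indicator _ (hEnm n)
      exact Complex.continuous_conj.measurable.comp hFtm
    have hφb : ∀ p, ‖φ p‖ₑ ≤ (En n).indicator (fun _ => (n : ENNReal)) p := by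
      intro p
      by_cases hp : p ∈ En n
      · simp only [hφ, Set.indicator_of_mem hp]
        have : ‖(starRingEnd ℂ) (Ft p)‖ₑ = ‖Ft p‖ₑ := by
          rw [← ofReal_norm, ← ofReal_norm, RCLike.norm_conj]
        rw [this]
        exact (enorm_integral_le_lintegral_enorm _).trans hp.1.2
      · simp [hφ, hp]
    have hφi : Integrable φ := by
      refine ⟨hφm.aestronglyMeasurable, ?_⟩
      refine (lintegral_mono hφb).trans_lt ?_
      rw [lintegral_indicator (hEnm n), setLIntegral_const]
      exact ENNReal.mul_lt_top (ENNReal.natCast_lt_top n) (hEnfin n)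
    set A := ∫⁻ p, ‖φ p‖ₑ ^ 2 with hA
    have hAeq : ∫⁻ p in En n, ‖Ft p‖ₑ ^ 2 = A := by
      rw [← lintegral_indicator (hEnm n)]
      congr 1
      ext p
      by_cases hp : p ∈ En n
      · simp only [hφ, Set.indicator_of_mem hp]
        rw [← ofReal_norm, ← ofReal_norm, RCLike.norm_conj]
      · simp [hφ, hp]
    have hAfin : A ≠ ⊤ := by
      refine ((lintegral_mono (g := (En n).indicator (fun _ => (n : ENNReal) ^ 2)) ?_).trans_lt
        ?_).ne
      · intro p
        refine (pow_le_pow_left' (hφb p) 2).trans ?_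
        by_cases hp : p ∈ En n <;> simp [hp]
      · rw [lintegral_indicator (hEnm n), setLIntegral_const]
        exact ENNReal.mul_lt_top (ENNReal.pow_lt_top (ENNReal.natCast_lt_top n)) (hEnfin n)
    -- Fubini
    have hfub : Integrable (Function.uncurry fun (p : ℝ × ℝ) (ξ : ℝ) => Jt (p, ξ) * φ p)
        ((volume : Measure (ℝ × ℝ)).prod (volume : Measure ℝ)) := by
      have hm : Measurable (Function.uncurry fun (p : ℝ × ℝ) (ξ : ℝ) => Jt (p, ξ) * φ p) :=
        hJtm.mul (hφm.comp measurable_fst)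
      refine ⟨hm.aestronglyMeasurable, ?_⟩
      unfold HasFiniteIntegral
      rw [lintegral_prod _ hm.enorm.aemeasurable]
      refine (lintegral_mono (g := (En n).indicator (fun _ => (n : ENNReal) * n)) ?_).trans_lt ?_
      · intro p
        simp only [Function.uncurry, enorm_mul]
        rw [lintegral_mul_const' _ _ enorm_ne_top]
        by_cases hp : p ∈ En n
        · simp only [Set.indicator_of_mem hp]
          refine mul_le_mul' hp.1.2 ?_
          simpa [hp] using hφb p
        · simp [hφ, hp]
      · rw [lintegral_indicator (hEnm n), setLIntegral_const]
        exact ENNReal.mul_lt_top (ENNReal.mul_lt_top (ENNReal.natCast_lt_top n)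
          (ENNReal.natCast_lt_top n)) (hEnfin n)
    have e1 : ∫ p, Ft p * φ p = ∫ ξ, ∫ p, Jt (p, ξ) * φ p := by
      rw [← integral_integral_swap hfub]
      congr 1
      ext p
      exact (integral_mul_const _ _).symm
    have e2 : ∫ p, Ft p * φ p = ((∫ p, ‖φ p‖ ^ 2 : ℝ) : ℂ) := by
      rw [← integral_complex_ofReal]
      congr 1
      ext p
      by_cases hp : p ∈ En n
      · simp only [hφ, Set.indicator_of_mem hp]
        rw [RCLike.norm_conj, Complex.mul_conj, Complex.normSq_eq_norm_sq]
      · simp [hφ, hp]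
    have e3 : A = ENNReal.ofReal (∫ p, ‖φ p‖ ^ 2) := by
      have hconv : ∀ p, ENNReal.ofReal (‖φ p‖ ^ 2) = ‖φ p‖ₑ ^ 2 := by
        intro p
        rw [ENNReal.ofReal_pow (norm_nonneg _), ofReal_norm]
      rw [integral_eq_lintegral_of_nonneg_ae (by filter_upwards with p; positivity)
        (hφm.norm.pow_const 2).aestronglyMeasurable]
      simp_rw [hconv]
      rw [ENNReal.ofReal_toReal hAfin]
    have e4 : A = ‖∫ p, Ft p * φ p‖ₑ := by
      rw [e2, e3, ← ofReal_norm, Complex.norm_real, Real.norm_eq_abs, abs_of_nonneg]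
      exact integral_nonneg fun p => by positivity
    rw [hAeq]
    apply ennreal_sq_cancel hAfin
    calc A = ‖∫ ξ, ∫ p, Jt (p, ξ) * φ p‖ₑ := by rw [e4, e1]
      _ ≤ ∫⁻ ξ, ‖∫ p, Jt (p, ξ) * φ p‖ₑ := enorm_integral_le_lintegral_enorm _
      _ = ∫⁻ ξ, ‖∫ p, J ξ p * φ p‖ₑ := by
          apply lintegral_congr_ae
          filter_upwards [hTae] with ξ hξ
          congr 2
          ext p
          by_cases hp : p ∈ En n
          · rw [hJtE p hp.1.1 ξ hξ]
          · simp [hφ, hp]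
      _ ≤ K * eLpNorm φ 2 volume := hdual φ hφm hφi
      _ = _ := by rw [sq_eLpNorm]
  have total : ∫⁻ p, ‖F p‖ₑ ^ 2 ≤ K ^ 2 := by
    rw [hgeq]
    calc ∫⁻ p, g p ≤ ∫⁻ p in ⋃ n, En n, ‖Ft p‖ₑ ^ 2 := by
          rw [← lintegral_indicator (MeasurableSet.iUnion hEnm)]
          apply lintegral_mono
          intro p
          by_cases hp : p ∈ E
          · rw [Set.indicator_of_mem (hEnU hp), hFtE p hp]
            exact hgle p
          · have : g p = 0 := by
              by_contra h0
              exact hp h0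
            rw [this]
            exact zero_le
      _ = ⨆ n, ∫⁻ p in En n, ‖Ft p‖ₑ ^ 2 :=
          setLIntegral_iUnion_of_directed _ hEnmono.directed_le
      _ ≤ K ^ 2 := iSup_le main
  rw [sq_eLpNorm]
  calc _ ≤ (K ^ 2) ^ (1 / 2 : ℝ) := ENNReal.rpow_le_rpow total (by norm_num)
    _ = K := by rw [← ENNReal.rpow_natCast, ← ENNReal.rpow_mul]; simp

/-- Bilinear Strichartz estimate for the Airy flow: if
`|m(ξ₁,ξ₂)| ≤ |ξ₁+ξ₂|^{1/2}|ξ₁−ξ₂|^{1/2}`, then for Airy evolutions `u, v` of `u₀, v₀`,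
`‖∫∫ m(ξ₁,ξ₂) û(t,ξ₁) e^{ixξ₁} v̂(t,ξ₂) e^{ixξ₂} dξ₁ dξ₂‖_{L²_{t,x}}
  ≤ C ‖u₀‖_{L²} ‖v₀‖_{L²}`. -/
theorem airy_bilinear_strichartz :
    ∃ C : ℝ, 0 < C ∧
      ∀ (m : ℝ → ℝ → ℂ),
        (∀ ξ₁ ξ₂ : ℝ, ‖m ξ₁ ξ₂‖ ≤ |ξ₁ + ξ₂| ^ ((1 : ℝ) / 2) * |ξ₁ - ξ₂| ^ ((1 : ℝ) / 2)) →
      ∀ (u₀ v₀ : ℝ → ℂ) (u v : ℝ → ℝ → ℂ),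
        (∀ t : ℝ, 𝓕 (u t) = fun ξ : ℝ => Complex.exp (Complex.I * t * (ξ : ℂ) ^ 3) * 𝓕 u₀ ξ) →
        (∀ t : ℝ, 𝓕 (v t) = fun ξ : ℝ => Complex.exp (Complex.I * t * (ξ : ℂ) ^ 3) * 𝓕 v₀ ξ) →
        eLpNorm (Function.uncurry (fun t x : ℝ =>
            ∫ ξ₁ : ℝ, ∫ ξ₂ : ℝ, m ξ₁ ξ₂ * 𝓕 (u t) ξ₁ * Complex.exp (Complex.I * x * ξ₁)
              * 𝓕 (v t) ξ₂ * Complex.exp (Complex.I * x * ξ₂)))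
            2 (volume : Measure (ℝ × ℝ))
          ≤ ENNReal.ofReal C * eLpNorm u₀ 2 volume * eLpNorm v₀ 2 volume := by
  refine ⟨4 * Real.pi, by positivity, ?_⟩
  intro m hm u₀ v₀ u v hu hv
  set G : ℝ → ℂ := 𝓕 u₀ with hG
  set H : ℝ → ℂ := 𝓕 v₀ with hH
  set k : ℝ → ℝ → ℂ := fun ξ₁ ξ₂ => m ξ₁ ξ₂ * G ξ₁ * H ξ₂ with hk
  classical
  set h : ℝ → ℝ → ℂ := fun ξ₁ => if Integrable (k ξ₁) then k ξ₁ else fun _ => 0 with hh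
  have hint : ∀ ξ₁, Integrable (h ξ₁) := by
    intro ξ₁
    by_cases hi : Integrable (k ξ₁)
    · simp only [hh, if_pos hi]; exact hi
    · simp only [hh, if_neg hi]; exact integrable_zero _ _ _
  have hkb : ∀ ξ₁ ξ₂, ‖k ξ₁ ξ₂‖ₑ ≤ ENNReal.ofReal (ww ξ₁ ξ₂) * (‖G ξ₁‖ₑ * ‖H ξ₂‖ₑ) := by
    intro ξ₁ ξ₂
    simp only [hk, enorm_mul]
    rw [mul_assoc]
    refine mul_le_mul_left ?_ _
    rw [← ofReal_norm]
    exact ENNReal.ofReal_le_ofReal (hm ξ₁ ξ₂)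
  have hb : ∀ ξ₁ ξ₂, ‖h ξ₁ ξ₂‖ₑ ≤ ENNReal.ofReal (ww ξ₁ ξ₂) * (‖G ξ₁‖ₑ * ‖H ξ₂‖ₑ) := by
    intro ξ₁ ξ₂
    by_cases hi : Integrable (k ξ₁)
    · simp only [hh, if_pos hi]; exact hkb ξ₁ ξ₂
    · simp only [hh, if_neg hi, enorm_zero]; exact zero_le
  have eec : ∀ p ξ₁, Continuous fun ξ₂ : ℝ => ee p (psi (ξ₁, ξ₂)) := fun p ξ₁ =>
    ee_cont.comp (continuous_const.prodMk (psi_cont.comp (by fun_prop)))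
  have hFeq : (Function.uncurry (fun t x : ℝ =>
            ∫ ξ₁ : ℝ, ∫ ξ₂ : ℝ, m ξ₁ ξ₂ * 𝓕 (u t) ξ₁ * Complex.exp (Complex.I * x * ξ₁)
              * 𝓕 (v t) ξ₂ * Complex.exp (Complex.I * x * ξ₂)))
      = fun p => ∫ ξ₁, ∫ ξ₂, h ξ₁ ξ₂ * ee p (psi (ξ₁, ξ₂)) := by
    ext p
    obtain ⟨t, x⟩ := p
    simp only [Function.uncurry]
    congr 1
    ext ξ₁
    have e1 : ∀ ξ₂ : ℝ, m ξ₁ ξ₂ * 𝓕 (u t) ξ₁ * Complex.exp (Complex.I * x * ξ₁)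
        * 𝓕 (v t) ξ₂ * Complex.exp (Complex.I * x * ξ₂)
        = k ξ₁ ξ₂ * ee (t, x) (psi (ξ₁, ξ₂)) := by
      intro ξ₂
      rw [hu, hv]
      have : ee (t, x) (psi (ξ₁, ξ₂)) = Complex.exp (Complex.I * t * (ξ₁ : ℂ) ^ 3)
          * Complex.exp (Complex.I * x * ξ₁) * Complex.exp (Complex.I * t * (ξ₂ : ℂ) ^ 3)
          * Complex.exp (Complex.I * x * ξ₂) := by
        rw [← Complex.exp_add, ← Complex.exp_add, ← Complex.exp_add]
        unfold ee psi
        congr 1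
        push_cast
        ring
      rw [this]
      simp only [hk]
      ring
    simp_rw [e1]
    by_cases hi : Integrable (k ξ₁)
    · simp only [hh, if_pos hi]
    · simp only [hh, if_neg hi, zero_mul, integral_zero]
      apply integral_undef
      intro hcon
      apply hi
      have h2 : Integrable (fun ξ₂ => (k ξ₁ ξ₂ * ee (t, x) (psi (ξ₁, ξ₂)))
          * (starRingEnd ℂ) (ee (t, x) (psi (ξ₁, ξ₂)))) := by
        refine hcon.mul_bdd (c := 1) ?_ ?_
        · exact (Complex.continuous_conj.comp (eec (t, x) ξ₁)).aestronglyMeasurable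
        · filter_upwards with ξ₂
          rw [RCLike.norm_conj, ee_norm]
      refine h2.congr ?_
      filter_upwards with ξ₂
      rw [mul_assoc, Complex.mul_conj, Complex.normSq_eq_norm_sq, ee_norm]
      simp
  rw [hFeq]
  have hJc : ∀ ξ₁, Continuous fun p => ∫ ξ₂, h ξ₁ ξ₂ * ee p (psi (ξ₁, ξ₂)) := by
    intro ξ₁
    refine continuous_of_dominated (bound := fun ξ₂ => ‖h ξ₁ ξ₂‖) ?_ ?_ (hint ξ₁).norm ?_
    · intro p
      exact (hint ξ₁).1.mul (eec p ξ₁).aestronglyMeasurable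
    · intro p
      filter_upwards with ξ₂
      rw [norm_mul, ee_norm, mul_one]
    · filter_upwards with ξ₂
      exact continuous_const.mul (ee_cont.comp (continuous_id.prodMk continuous_const))
  have key := duality (fun ξ₁ p => ∫ ξ₂, h ξ₁ ξ₂ * ee p (psi (ξ₁, ξ₂))) hJc
    (ENNReal.ofReal (4 * Real.pi) * eLpNorm G 2 volume * eLpNorm H 2 volume)
    (fun φ hφ hφi => dual_estimate h G H (fourier_cont u₀) (fourier_cont v₀) hint hb φ hφ hφi)
  refine key.trans ?_
  gcongr
  · exact plancherel_le u₀
  · exact plancherel_le v₀
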